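/- Let m ≥ 1 be an integer, and for each i ∈ {1,…,m} let α_i ∈ (1,2), l_i > 0, and n_i ≥ 1. Define q(θ) = Σ_{i=1}^m l_i·|θ_i|^{α_i} on [−π,π]^m and set c_2 = max_{1≤i≤m} π²/(−8·cos(πα_i/2)). Let p : [−π,π]^m → ℝ be integrable with c_0·q(θ) ≤ p(θ) ≤ c_1·q(θ) for all θ, where 0 < c_0 ≤ c_1. Let B be the multilevel Toeplitz matrix (with sizes n_1,…,n_m) generated by p, and let T = Σ_{i=1}^m I_{n_1}⊗⋯⊗I_{n_{i−1}}⊗(l_i·τ(G_{n_i}^{(α_i)}))⊗I_{n_{i+1}}⊗⋯⊗I_{n_m} be the multilevel τ-preconditioner. Then for every nonzero real vector z of size N = n_1⋯n_m one has (c_0/4)·zᵀTz ≤ zᵀBz ≤ (3·c_1·c_2/2)·zᵀTz; in particular, the spectrum of T^{−1}B is contained in [c_0/4, 3c_1c_2/2], bounds independent of the matrix size. -/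

import Mathlib

open Real Matrix

/-- Grünwald–Letnikov coefficients: `g 0 = 1`, `g k = (1 - (α+1)/k) * g (k-1)` for `k ≥ 1`. -/
noncomputable def glCoef (α : ℝ) : ℕ → ℝ
  | 0 => 1
  | k + 1 => (1 - (α + 1) / ((k : ℝ) + 1)) * glCoef α k

/-- First-column entries of `G_n^{(α)}`: `t_0 = -2g_1`, `t_1 = -(g_0+g_2)`, `t_k = -g_{k+1}` for `k ≥ 2`. -/
noncomputable def tC (α : ℝ) : ℕ → ℝ
  | 0 => -2 * glCoef α 1
  | 1 => -(glCoef α 0 + glCoef α 2)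
  | k + 2 => -glCoef α (k + 3)

/-- Padded coefficients: `t_k` for `k < n`, `0` for `k ≥ n`. -/
noncomputable def tpad (n : ℕ) (t : ℕ → ℝ) (k : ℕ) : ℝ := if k < n then t k else 0

/-- The `n×n` symmetric Toeplitz matrix with `(i,j)` entry `t_{|i-j|}`. -/
noncomputable def toeplitzM (n : ℕ) (t : ℕ → ℝ) : Matrix (Fin n) (Fin n) ℝ :=
  fun i j => t (Nat.dist i.val j.val)

/-- The Hankel matrix `(H_n)_{ij} = t_{i+j} + t_{2(n+1)-(i+j)}` (1-based indices,
with the convention `t_k = 0` for `k ≥ n`). Here `i j : Fin n` are 0-based. -/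
noncomputable def hankelM (n : ℕ) (t : ℕ → ℝ) : Matrix (Fin n) (Fin n) ℝ :=
  fun i j => tpad n t (i.val + j.val + 2) + tpad n t (2 * n - (i.val + j.val))

/-- The τ-matrix `τ(T_n) = T_n - H_n`. -/
noncomputable def tauM (n : ℕ) (t : ℕ → ℝ) : Matrix (Fin n) (Fin n) ℝ :=
  toeplitzM n t - hankelM n t

/-- The matrix `G_n^{(α)}`. -/
noncomputable def Gmat (α : ℝ) (n : ℕ) : Matrix (Fin n) (Fin n) ℝ := toeplitzM n (tC α)

/-- The multilevel matrix `Σ_i I_{n_1}⊗⋯⊗M_i⊗⋯⊗I_{n_m}`, indexed by tuples `x y` with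
`(x,y)` entry `Σ_i (M_i)_{x_i y_i} · Π_{j ≠ i} [x_j = y_j]`. -/
noncomputable def multilevel {m : ℕ} (n : Fin m → ℕ)
    (M : (i : Fin m) → Matrix (Fin (n i)) (Fin (n i)) ℝ) :
    Matrix ((i : Fin m) → Fin (n i)) ((i : Fin m) → Fin (n i)) ℝ :=
  fun x y => ∑ i, M i (x i) (y i) * ∏ j ∈ Finset.univ.erase i, (if x j = y j then (1 : ℝ) else 0)

open MeasureTheory

/-- The multilevel Toeplitz matrix generated by an integrable `f` on `[-π,π]^m`:
the `(x,y)` entry is `(2π)^{-m} ∫_{[-π,π]^m} f(θ) cos(Σ_i θ_i (x_i - y_i)) dθ`. -/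
noncomputable def mToeplitz {m : ℕ} (n : Fin m → ℕ) (f : (Fin m → ℝ) → ℝ) :
    Matrix ((i : Fin m) → Fin (n i)) ((i : Fin m) → Fin (n i)) ℝ :=
  fun x y => (2 * Real.pi) ^ (-(m : ℤ)) *
    ∫ θ in Set.univ.pi fun _ : Fin m => Set.Icc (-Real.pi) Real.pi,
      f θ * Real.cos (∑ i, θ i * (((x i : ℕ) : ℝ) - ((y i : ℕ) : ℝ)))

open Filter Topology

lemma glCoef_succ (α : ℝ) (k : ℕ) :
    glCoef α (k + 1) = (1 - (α + 1) / ((k : ℝ) + 1)) * glCoef α k := rfl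

lemma glCoef_one (α : ℝ) : glCoef α 1 = -α := by
  simp [glCoef]

lemma glCoef_eq_choose (α : ℝ) (k : ℕ) :
    glCoef α k = (-1) ^ k * Ring.choose α k := by
  induction k with
  | zero => simp [glCoef]
  | succ k ih =>
    have h := Ring.choose_smul_choose α (Nat.le_succ k)
    simp only [Nat.succ_eq_add_one, Nat.choose_succ_self_right, nsmul_eq_mul,
      Nat.add_sub_cancel_left, Ring.choose_one_right] at h
    have hk : (k : ℝ) + 1 ≠ 0 := by positivity
    rw [glCoef_succ, ih]
    push_cast at h
    have h' : Ring.choose α (k + 1) = Ring.choose α k * (α - k) / (k + 1) := by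
      field_simp
      linarith
    rw [h']
    field_simp
    ring

lemma glCoef_pos {α : ℝ} (hα : α ∈ Set.Ioo (1 : ℝ) 2) (k : ℕ) : 0 < glCoef α (k + 2) := by
  obtain ⟨h1, h2⟩ := hα
  induction k with
  | zero =>
    rw [zero_add, glCoef_succ, glCoef_one]
    push_cast
    nlinarith
  | succ k ih =>
    rw [glCoef_succ]
    refine mul_pos ?_ ih
    rw [sub_pos, div_lt_one (by positivity)]
    push_cast
    have : (0 : ℝ) ≤ k := k.cast_nonneg
    linarith

lemma glCoef_antitone {α : ℝ} (hα : α ∈ Set.Ioo (1 : ℝ) 2) :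
    Antitone fun k => glCoef α (k + 2) := by
  refine antitone_nat_of_succ_le fun k => ?_
  change glCoef α (k + 2 + 1) ≤ _
  rw [glCoef_succ]
  refine mul_le_of_le_one_left (glCoef_pos hα k).le ?_
  have h1 := hα.1
  have : 0 ≤ (α + 1) / (((k + 2 : ℕ) : ℝ) + 1) := by positivity
  linarith

/-- Partial sums of the coefficients of `(1 - z) ^ α` are the coefficients of
`(1 - z) ^ (α - 1)`. -/
lemma sum_glCoef (α : ℝ) (n : ℕ) :
    ∑ k ∈ Finset.range (n + 1), glCoef α k = glCoef (α - 1) n := by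
  have aux : ∀ n : ℕ, ∑ k ∈ Finset.range (n + 1), glCoef α k = glCoef (α - 1) n ∧
      α * glCoef (α - 1) n = (α - n) * glCoef α n := by
    intro n
    induction n with
    | zero => simp [glCoef]
    | succ n ih =>
      obtain ⟨h1, h2⟩ := ih
      have hn : (n : ℝ) + 1 ≠ 0 := by positivity
      have key : glCoef (α - 1) n + glCoef α (n + 1) = glCoef (α - 1) (n + 1) := by
        rw [glCoef_succ, glCoef_succ]
        field_simp
        linarith
      refine ⟨by rw [Finset.sum_range_succ, h1, key], ?_⟩
      rw [glCoef_succ, glCoef_succ]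
      push_cast
      field_simp
      linear_combination (n + 1 - α) * h2
  exact (aux n).1

lemma sum_glCoef_nonpos {α : ℝ} (hα : α ∈ Set.Ioo (1 : ℝ) 2) (n : ℕ) :
    ∑ k ∈ Finset.range (n + 2), glCoef α k ≤ 0 := by
  rw [sum_glCoef]
  obtain ⟨h1, h2⟩ := hα
  induction n with
  | zero => rw [glCoef_one]; linarith
  | succ n ih =>
    rw [glCoef_succ]
    refine mul_nonpos_of_nonneg_of_nonpos ?_ ih
    rw [sub_nonneg, div_le_one (by positivity)]
    push_cast
    have : (0 : ℝ) ≤ n := n.cast_nonneg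
    linarith

lemma summable_glCoef {α : ℝ} (hα : α ∈ Set.Ioo (1 : ℝ) 2) : Summable (glCoef α) := by
  rw [← summable_nat_add_iff 2]
  refine summable_of_sum_range_le (c := α - 1) (fun k => (glCoef_pos hα k).le) fun n => ?_
  have := sum_glCoef_nonpos hα n
  rw [Finset.sum_range_succ', Finset.sum_range_succ'] at this
  simp only [zero_add, glCoef_one] at this
  have h0 : glCoef α 0 = 1 := rfl
  linarith

lemma tC_nonpos {α : ℝ} (hα : α ∈ Set.Ioo (1 : ℝ) 2) {k : ℕ} (hk : k ≠ 0) : tC α k ≤ 0 := by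
  match k, hk with
  | 1, _ =>
    have := glCoef_pos hα 0
    have h0 : glCoef α 0 = 1 := rfl
    simp only [tC]
    simp only [zero_add] at this
    linarith
  | k + 2, _ => simpa [tC] using (glCoef_pos hα (k + 1)).le

lemma tC_mono {α : ℝ} (hα : α ∈ Set.Ioo (1 : ℝ) 2) {j k : ℕ} (hj : j ≠ 0) (hjk : j ≤ k) :
    tC α j ≤ tC α k := by
  match j, k, hj, hjk with
  | 1, 1, _, _ => exact le_rfl
  | 1, k + 2, _, _ =>
    have := glCoef_antitone hα (Nat.zero_le (k + 1))
    have h0 : glCoef α 0 = 1 := rfl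
    simp only [tC]
    simp only [zero_add] at this
    change glCoef α (k + 3) ≤ _ at this
    linarith
  | j + 2, k + 2, _, h =>
    have := glCoef_antitone hα (show j + 1 ≤ k + 1 by omega)
    simpa [tC] using this

lemma tC_zero_add_sum_nonneg {α : ℝ} (hα : α ∈ Set.Ioo (1 : ℝ) 2) (n : ℕ) :
    0 ≤ tC α 0 + 2 * ∑ k ∈ Finset.range n, tC α (k + 1) := by
  have key : ∀ n : ℕ, tC α 0 + 2 * ∑ k ∈ Finset.range (n + 1), tC α (k + 1) =
      -2 * ∑ k ∈ Finset.range (n + 3), glCoef α k := by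
    intro n
    induction n with
    | zero =>
      simp only [Finset.sum_range_succ, Finset.range_zero, Finset.sum_empty, tC]
      ring
    | succ n ih =>
      rw [Finset.sum_range_succ, mul_add, ← add_assoc, ih, Finset.sum_range_succ _ (n + 3)]
      simp only [tC]
      ring
  cases n with
  | zero =>
    simp only [tC, glCoef_one, Finset.range_zero, Finset.sum_empty]
    linarith [hα.1]
  | succ n =>
    rw [key]
    linarith [sum_glCoef_nonpos hα (n + 1)]

lemma Matrix.posSemidef_of_sum_abs_le {ι : Type*} [Fintype ι] [DecidableEq ι] {A : Matrix ι ι ℝ}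
    (hA : A.IsHermitian) (h : ∀ i, ∑ j ∈ Finset.univ.erase i, |A i j| ≤ A i i) :
    A.PosSemidef := by
  refine .of_dotProduct_mulVec_nonneg hA fun x => ?_
  have hsymm : ∀ i j, A i j = A j i := fun i j => by simpa using hA.apply j i
  set D : ι → ι → ℝ := fun i j => if i = j then 0 else |A i j| with hD
  have hDs : ∀ i j, D i j = D j i := fun i j => by simp [hD, eq_comm, hsymm i j]
  have hrow : ∀ i, ∑ j, D i j ≤ A i i := fun i => by
    refine le_trans (le_of_eq ?_) (h i)
    rw [← Finset.add_sum_erase _ _ (Finset.mem_univ i)]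
    simp only [hD, if_true, zero_add]
    exact Finset.sum_congr rfl fun j hj => if_neg (Finset.ne_of_mem_erase hj).symm
  have hterm : ∀ i j, (if i = j then A i i * x i ^ 2 else 0) - D i j * ((x i ^ 2 + x j ^ 2) / 2)
      ≤ x i * (A i j * x j) := fun i j => by
    by_cases hij : i = j
    · subst hij
      simp only [hD, if_true, zero_mul, sub_zero]
      exact le_of_eq (by ring)
    · simp only [hD, hij, if_false, zero_sub]
      have h1 : |x i * (A i j * x j)| = |A i j| * (|x i| * |x j|) := by
        simp only [abs_mul]; ring
      have h2 : |x i| * |x j| ≤ (x i ^ 2 + x j ^ 2) / 2 := by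
        nlinarith [sq_nonneg (|x i| - |x j|), sq_abs (x i), sq_abs (x j)]
      have h3 := neg_abs_le (x i * (A i j * x j))
      have h4 := mul_le_mul_of_nonneg_left h2 (abs_nonneg (A i j))
      linarith
  have hswap : ∑ i, ∑ j, D i j * x j ^ 2 = ∑ i, ∑ j, D i j * x i ^ 2 := by
    rw [Finset.sum_comm]
    simp_rw [hDs]
  have hsum : ∑ i, ∑ j, ((if i = j then A i i * x i ^ 2 else 0) -
      D i j * ((x i ^ 2 + x j ^ 2) / 2)) = ∑ i, (A i i - ∑ j, D i j) * x i ^ 2 := by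
    have : ∀ i j, D i j * ((x i ^ 2 + x j ^ 2) / 2) =
        D i j * x i ^ 2 / 2 + D i j * x j ^ 2 / 2 := fun i j => by ring
    simp only [this, Finset.sum_sub_distrib, Finset.sum_add_distrib, Finset.sum_ite_eq,
      Finset.mem_univ, if_true, sub_mul, Finset.sum_mul, ← Finset.sum_div, hswap]
    ring
  calc (0 : ℝ) ≤ ∑ i, (A i i - ∑ j, D i j) * x i ^ 2 :=
        Finset.sum_nonneg fun i _ => mul_nonneg (sub_nonneg.2 (hrow i)) (sq_nonneg _)
    _ ≤ ∑ i, ∑ j, x i * (A i j * x j) := by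
        rw [← hsum]
        exact Finset.sum_le_sum fun i _ => Finset.sum_le_sum fun j _ => hterm i j
    _ = star x ⬝ᵥ A *ᵥ x := by
        simp [dotProduct, mulVec, Finset.mul_sum]

section Toeplitz

variable {n : ℕ} {t : ℕ → ℝ}

lemma tpad_nonpos (ht : ∀ k ≠ 0, t k ≤ 0) {k : ℕ} (hk : k ≠ 0) : tpad n t k ≤ 0 := by
  unfold tpad
  split_ifs
  exacts [ht k hk, le_rfl]

lemma tpad_of_le {k : ℕ} (hk : n ≤ k) : tpad n t k = 0 := if_neg (by omega)

lemma le_tpad (ht : ∀ k ≠ 0, t k ≤ 0) (hmono : ∀ j k, j ≠ 0 → j ≤ k → t j ≤ t k) {j k : ℕ}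
    (hj : j ≠ 0) (hjk : j ≤ k) : t j ≤ tpad n t k := by
  unfold tpad
  split_ifs
  exacts [hmono j k hj hjk, ht j hj]

lemma hankelM_nonpos (ht : ∀ k ≠ 0, t k ≤ 0) (i j : Fin n) : hankelM n t i j ≤ 0 :=
  add_nonpos (tpad_nonpos ht (by omega)) (tpad_nonpos ht (by omega))

lemma toeplitzM_le_hankelM (ht : ∀ k ≠ 0, t k ≤ 0) (hmono : ∀ j k, j ≠ 0 → j ≤ k → t j ≤ t k)
    {i j : Fin n} (hij : i ≠ j) : toeplitzM n t i j ≤ hankelM n t i j := by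
  have hij' : (i : ℕ) ≠ j := fun h => hij (Fin.ext h)
  have hd : Nat.dist i j ≠ 0 := fun h => hij' (Nat.eq_of_dist_eq_zero h)
  have hi := i.2
  have hj := j.2
  simp only [toeplitzM, hankelM]
  by_cases h : n ≤ (i : ℕ) + j + 2
  · rw [tpad_of_le h, zero_add]
    exact le_tpad ht hmono hd (by unfold Nat.dist; omega)
  · rw [tpad_of_le (k := 2 * n - (i + j)) (by omega), add_zero]
    exact le_tpad ht hmono hd (by unfold Nat.dist; omega)

lemma sum_le_sum_add_sum_tpad (ht : ∀ k ≠ 0, t k ≤ 0) {s : ℕ} (hs : s < n) :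
    ∑ k ∈ Finset.range n, t (k + 1) ≤
      ∑ k ∈ Finset.range s, t (k + 1) + ∑ j ∈ Finset.range n, tpad n t (s + 2 + j) := by
  obtain ⟨r, rfl⟩ : ∃ r, n = s + 1 + r := ⟨n - (s + 1), by omega⟩
  have h1 : ∑ j ∈ Finset.range r, t (s + 2 + j) ≤
      ∑ j ∈ Finset.range (s + 1 + r), tpad (s + 1 + r) t (s + 2 + j) := by
    rw [add_comm (s + 1) r, Finset.sum_range_add]
    have h0 : ∑ x ∈ Finset.range (s + 1), tpad (r + (s + 1)) t (s + 2 + (r + x)) = 0 :=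
      Finset.sum_eq_zero fun x _ => tpad_of_le (by omega)
    rw [h0, add_zero]
    refine Finset.sum_le_sum fun j _ => ?_
    unfold tpad
    split_ifs
    exacts [le_rfl, ht _ (by omega)]
  rw [Finset.sum_range_add, Finset.sum_range_succ]
  have h2 : ∑ x ∈ Finset.range r, t (s + 1 + x + 1) = ∑ j ∈ Finset.range r, t (s + 2 + j) :=
    Finset.sum_congr rfl fun x _ => by congr 1; omega
  have h3 := ht (s + 1) (by omega)
  linarith

lemma sum_toeplitzM_add_hankelM_nonneg (ht : ∀ k ≠ 0, t k ≤ 0)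
    (hsum : 0 ≤ t 0 + 2 * ∑ k ∈ Finset.range n, t (k + 1)) (i : Fin n) :
    0 ≤ ∑ j, (toeplitzM n t i j + hankelM n t i j) := by
  obtain ⟨i, hi⟩ := i
  obtain ⟨r, hr⟩ : ∃ r, n = i + 1 + r := ⟨n - (i + 1), by omega⟩
  have hT : ∑ j : Fin n, toeplitzM n t ⟨i, hi⟩ j =
      t 0 + ∑ k ∈ Finset.range i, t (k + 1) + ∑ k ∈ Finset.range r, t (k + 1) := by
    simp only [toeplitzM]
    rw [Fin.sum_univ_eq_sum_range (fun j => t (Nat.dist i j)) n, hr, Finset.sum_range_add]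
    congr 1
    · rw [← Finset.sum_range_reflect, Finset.sum_range_succ', add_comm]
      congr 1
      · congr 1; unfold Nat.dist; omega
      · refine Finset.sum_congr rfl fun k hk => ?_
        have := Finset.mem_range.1 hk
        congr 1; unfold Nat.dist; omega
    · refine Finset.sum_congr rfl fun k hk => ?_
      congr 1; unfold Nat.dist; omega
  have hH : ∑ j : Fin n, hankelM n t ⟨i, hi⟩ j =
      ∑ j ∈ Finset.range n, tpad n t (i + 2 + j) + ∑ j ∈ Finset.range n, tpad n t (r + 2 + j) := by
    simp only [hankelM]
    rw [Fin.sum_univ_eq_sum_range (fun j => tpad n t (i + j + 2) + tpad n t (2 * n - (i + j))) n,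
      Finset.sum_add_distrib]
    congr 1
    · exact Finset.sum_congr rfl fun k hk => by congr 1; omega
    · rw [← Finset.sum_range_reflect]
      refine Finset.sum_congr rfl fun k hk => ?_
      have := Finset.mem_range.1 hk
      congr 1; omega
  rw [Finset.sum_add_distrib, hT, hH]
  have h1 := sum_le_sum_add_sum_tpad ht hi
  have h2 := sum_le_sum_add_sum_tpad ht (show r < n by omega)
  linarith

/-- The hypothesis on `c` keeps `T + c H` diagonally dominant. -/
lemma posSemidef_toeplitzM_add_smul_hankelM (ht : ∀ k ≠ 0, t k ≤ 0)
    (hmono : ∀ j k, j ≠ 0 → j ≤ k → t j ≤ t k)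
    (hsum : 0 ≤ t 0 + 2 * ∑ k ∈ Finset.range n, t (k + 1)) {c : ℝ} (hc : c ∈ Set.Icc (-3) 1) :
    (toeplitzM n t + c • hankelM n t).PosSemidef := by
  obtain ⟨hc1, hc2⟩ := hc
  refine posSemidef_of_sum_abs_le ?_ fun i => ?_
  · refine Matrix.IsHermitian.ext fun i j => ?_
    simp [toeplitzM, hankelM, Nat.dist_comm, add_comm]
  have hrow := sum_toeplitzM_add_hankelM_nonneg ht hsum i
  rw [← Finset.add_sum_erase _ _ (Finset.mem_univ i)] at hrow
  have hoff : ∑ j ∈ Finset.univ.erase i, |(toeplitzM n t + c • hankelM n t) i j| ≤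
      ∑ j ∈ Finset.univ.erase i, -(toeplitzM n t i j + hankelM n t i j) := by
    refine Finset.sum_le_sum fun j hj => ?_
    have h1 := hankelM_nonpos ht i j
    have h2 := toeplitzM_le_hankelM ht hmono (Finset.ne_of_mem_erase hj).symm
    simp only [Matrix.add_apply, Matrix.smul_apply, smul_eq_mul]
    rw [abs_le]
    constructor <;> nlinarith
  rw [Finset.sum_neg_distrib] at hoff
  have h1 := hankelM_nonpos ht i i
  simp only [Matrix.add_apply, Matrix.smul_apply, smul_eq_mul] at hoff ⊢
  nlinarith

end Toeplitz

section Multilevel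

variable {m : ℕ} {n : Fin m → ℕ}

lemma multilevel_posSemidef {M : (i : Fin m) → Matrix (Fin (n i)) (Fin (n i)) ℝ}
    (hM : ∀ i, (M i).PosSemidef) : (multilevel n M).PosSemidef := by
  have h : multilevel n M = ∑ i, (M i).submatrix (fun x => x i) (fun x => x i) ⊙
      (1 : Matrix ((j : {j // j ≠ i}) → Fin (n j)) ((j : {j // j ≠ i}) → Fin (n j)) ℝ).submatrix
        (fun (x : (i : Fin m) → Fin (n i)) (j : {j // j ≠ i}) => x j) (fun x j => x j) := by
    ext x y
    simp only [multilevel, Matrix.sum_apply, Matrix.hadamard_apply, Matrix.submatrix_apply,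
      Matrix.one_apply, Finset.prod_ite_zero, Finset.prod_const_one, Finset.mem_erase,
      Finset.mem_univ, and_true, funext_iff, Subtype.forall]
  rw [h]
  exact Matrix.posSemidef_sum _ fun i _ =>
    ((hM i).submatrix _).hadamard (Matrix.PosSemidef.one.submatrix _)

lemma multilevel_dotProduct_mono {M M' : (i : Fin m) → Matrix (Fin (n i)) (Fin (n i)) ℝ}
    {a b : ℝ} (h : ∀ i, (b • M' i - a • M i).PosSemidef) (z : ((i : Fin m) → Fin (n i)) → ℝ) :
    a * (z ⬝ᵥ multilevel n M *ᵥ z) ≤ b * (z ⬝ᵥ multilevel n M' *ᵥ z) := by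
  have h1 : multilevel n (fun i => b • M' i - a • M i) =
      b • multilevel n M' - a • multilevel n M := by
    ext x y
    simp only [multilevel, Matrix.sub_apply, Matrix.smul_apply, smul_eq_mul, Finset.mul_sum,
      ← Finset.sum_sub_distrib]
    exact Finset.sum_congr rfl fun i _ => by ring
  have h2 := (multilevel_posSemidef h).dotProduct_mulVec_nonneg z
  rw [h1, Matrix.sub_mulVec, Matrix.smul_mulVec, Matrix.smul_mulVec, dotProduct_sub,
    dotProduct_smul, dotProduct_smul] at h2
  simpa using h2

end Multilevel

lemma posSemidef_two_smul_Gmat_sub_tauM {α : ℝ} (hα : α ∈ Set.Ioo (1 : ℝ) 2) (n : ℕ) :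
    ((2 : ℝ) • Gmat α n - tauM n (tC α)).PosSemidef := by
  have := posSemidef_toeplitzM_add_smul_hankelM (n := n) (fun _ => tC_nonpos hα)
    (fun _ _ => tC_mono hα) (tC_zero_add_sum_nonneg hα n) (c := 1) (by norm_num)
  convert this using 1
  simp only [Gmat, tauM]
  module

lemma posSemidef_three_smul_tauM_sub_Gmat {α : ℝ} (hα : α ∈ Set.Ioo (1 : ℝ) 2) (n : ℕ) :
    ((3 : ℝ) • tauM n (tC α) - (2 : ℝ) • Gmat α n).PosSemidef := by
  have := posSemidef_toeplitzM_add_smul_hankelM (n := n) (fun _ => tC_nonpos hα)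
    (fun _ _ => tC_mono hα) (tC_zero_add_sum_nonneg hα n) (c := -3) (by norm_num)
  convert this using 1
  simp only [Gmat, tauM]
  module

section Symbol

variable {α : ℝ}

lemma hasSum_glCoef_mul_pow (α : ℝ) {z : ℂ} (hz : ‖z‖ < 1) :
    HasSum (fun k => (glCoef α k : ℂ) * z ^ k) ((1 - z) ^ (α : ℂ)) := by
  have h := (Complex.one_add_cpow_hasFPowerSeriesOnBall_zero (a := (α : ℂ))).hasSum (y := -z)
    (by simpa [Metric.mem_eball, edist_zero_right, enorm_eq_nnnorm, ← NNReal.coe_lt_coe] using hz)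
  simp only [binomialSeries_apply, List.ofFn_const, List.prod_replicate,
    smul_eq_mul, ← sub_eq_add_neg] at h
  rw [zero_sub, ← sub_eq_add_neg] at h
  refine h.congr_fun fun k => ?_
  rw [glCoef_eq_choose, Complex.ofReal_mul, Complex.ofReal_choose, neg_pow z]
  push_cast
  ring

lemma tsum_glCoef_mul_pow (hα : α ∈ Set.Ioo (1 : ℝ) 2) {z : ℂ} (hz : ‖z‖ = 1) :
    ∑' k, (glCoef α k : ℂ) * z ^ k = (1 - z) ^ (α : ℂ) := by
  have hsum : Summable fun k => ‖glCoef α k‖ := (summable_glCoef hα).norm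
  have hmem : Set.Ioo (0 : ℝ) 1 ∈ 𝓝[<] (1 : ℝ) := Ioo_mem_nhdsLT zero_lt_one
  have hlim : Tendsto (fun r : ℝ => ∑' k, (glCoef α k : ℂ) * ((r : ℂ) * z) ^ k) (𝓝[<] 1)
      (𝓝 (∑' k, (glCoef α k : ℂ) * z ^ k)) := by
    refine tendsto_tsum_of_dominated_convergence hsum (fun k => ?_) ?_
    · have : Continuous fun r : ℝ => (glCoef α k : ℂ) * ((r : ℂ) * z) ^ k := by fun_prop
      simpa using (this.tendsto 1).mono_left nhdsWithin_le_nhds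
    · filter_upwards [hmem] with r hr k
      rw [norm_mul, norm_pow, norm_mul, hz, mul_one, Complex.norm_real, Complex.norm_real]
      refine mul_le_of_le_one_right (norm_nonneg _) (pow_le_one₀ (norm_nonneg _) ?_)
      rw [Real.norm_of_nonneg hr.1.le]
      exact hr.2.le
  have hlim' : Tendsto (fun r : ℝ => (1 - (r : ℂ) * z) ^ (α : ℂ)) (𝓝[<] 1)
      (𝓝 ((1 - z) ^ (α : ℂ))) := by
    have h1 : ContinuousAt (fun w : ℂ => w ^ (α : ℂ)) (1 - z) := by
      refine Complex.continuousAt_cpow_const_of_re_pos (Or.inl ?_) ?_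
      · simpa [hz] using Complex.re_le_norm z
      · simpa using (zero_lt_one.trans hα.1)
    have h2 : Tendsto (fun r : ℝ => 1 - (r : ℂ) * z) (𝓝[<] 1) (𝓝 (1 - z)) := by
      have : Continuous fun r : ℝ => 1 - (r : ℂ) * z := by fun_prop
      simpa using (this.tendsto 1).mono_left nhdsWithin_le_nhds
    exact h1.tendsto.comp h2
  refine tendsto_nhds_unique (hlim.congr' ?_) hlim'
  filter_upwards [hmem] with r hr
  refine (hasSum_glCoef_mul_pow α ?_).tsum_eq
  rw [norm_mul, hz, mul_one, Complex.norm_real, Real.norm_of_nonneg hr.1.le]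
  exact hr.2

lemma one_sub_exp_cpow (hα : 0 < α) {θ : ℝ} (hθ : θ ∈ Set.Icc 0 π) :
    (1 - Complex.exp (θ * Complex.I)) ^ (α : ℂ) =
      ((2 * Real.sin (θ / 2)) ^ α : ℝ) * Complex.exp ((α * (θ - π) / 2 : ℝ) * Complex.I) := by
  obtain ⟨h0, h1⟩ := hθ
  have hs : 0 ≤ 2 * Real.sin (θ / 2) :=
    mul_nonneg zero_le_two (Real.sin_nonneg_of_nonneg_of_le_pi (by linarith) (by linarith))
  have hpolar : 1 - Complex.exp (θ * Complex.I) =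
      (2 * Real.sin (θ / 2) : ℝ) * Complex.exp (((θ - π) / 2 : ℝ) * Complex.I) := by
    have hc : Real.cos ((θ - π) / 2) = Real.sin (θ / 2) := by
      rw [← Real.cos_sub_pi_div_two]; congr 1; ring
    have hs : Real.sin ((θ - π) / 2) = -Real.cos (θ / 2) := by
      rw [← Real.sin_sub_pi_div_two]; congr 1; ring
    have h2 : θ = 2 * (θ / 2) := by ring
    apply Complex.ext
    · simp only [Complex.sub_re, Complex.one_re, Complex.exp_ofReal_mul_I_re, Complex.re_ofReal_mul,
        hc]
      conv_lhs => rw [h2, Real.cos_two_mul, Real.cos_sq']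
      ring
    · simp only [Complex.sub_im, Complex.one_im, Complex.exp_ofReal_mul_I_im, Complex.im_ofReal_mul,
        hs]
      conv_lhs => rw [h2, Real.sin_two_mul]
      ring
  rw [hpolar]
  rcases hs.eq_or_lt with h | h
  · rw [← h, Real.zero_rpow hα.ne', Complex.ofReal_zero, zero_mul, zero_mul,
      Complex.zero_cpow (by exact_mod_cast hα.ne')]
  rw [Complex.ofReal_cpow hs, Complex.cpow_def_of_ne_zero
      (mul_ne_zero (by exact_mod_cast h.ne') (Complex.exp_ne_zero _)),
    Complex.cpow_def_of_ne_zero (by exact_mod_cast h.ne'),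
    Complex.log_ofReal_mul h (Complex.exp_ne_zero _), Complex.log_exp,
    Complex.ofReal_log hs, ← Complex.exp_add]
  · congr 1; push_cast; ring
  · simp; linarith [Real.pi_pos]
  · simp; linarith [Real.pi_pos]

/-- The generating function of the Toeplitz matrices `G_n^{(α)}`. -/
noncomputable def glSymbol (α θ : ℝ) : ℝ := -2 * ∑' k : ℕ, glCoef α k * Real.cos ((k - 1) * θ)

lemma glSymbol_neg (α θ : ℝ) : glSymbol α (-θ) = glSymbol α θ := by
  simp [glSymbol]

lemma continuous_glSymbol (hα : α ∈ Set.Ioo (1 : ℝ) 2) : Continuous (glSymbol α) := by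
  refine continuous_const.mul (continuous_tsum (fun k => by fun_prop) (summable_glCoef hα).norm ?_)
  intro k θ
  rw [norm_mul]
  exact mul_le_of_le_one_right (norm_nonneg _) (Real.abs_cos_le_one _)

lemma glSymbol_eq (hα : α ∈ Set.Ioo (1 : ℝ) 2) {θ : ℝ} (hθ : θ ∈ Set.Icc 0 π) :
    glSymbol α θ =
      -2 * ((2 * Real.sin (θ / 2)) ^ α * Real.cos (π * α / 2 + θ * (1 - α / 2))) := by
  have hα0 : 0 < α := by linarith [hα.1]
  have h1 := tsum_glCoef_mul_pow hα (Complex.norm_exp_ofReal_mul_I θ)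
  have hsm : Summable fun k => (glCoef α k : ℂ) * Complex.exp (θ * Complex.I) ^ k := by
    refine Summable.of_norm ((summable_glCoef hα).norm.congr fun k => ?_)
    rw [norm_mul, norm_pow, Complex.norm_exp_ofReal_mul_I, one_pow, mul_one, Complex.norm_real]
  have h2 : ∑' k : ℕ, glCoef α k * Real.cos ((k - 1) * θ) =
      (Complex.exp ((-θ : ℝ) * Complex.I) *
        ∑' k, (glCoef α k : ℂ) * Complex.exp (θ * Complex.I) ^ k).re := by
    rw [← tsum_mul_left, Complex.re_tsum (hsm.mul_left _)]
    refine tsum_congr fun k => ?_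
    rw [← Complex.exp_nat_mul, mul_left_comm, ← Complex.exp_add, Complex.re_ofReal_mul]
    congr 1
    rw [← Complex.exp_ofReal_mul_I_re]
    congr 2
    push_cast
    ring
  rw [glSymbol, h2, h1, one_sub_exp_cpow hα0 hθ, mul_left_comm, ← Complex.exp_add,
    Complex.re_ofReal_mul, ← add_mul, ← Complex.ofReal_add, Complex.exp_ofReal_mul_I_re,
    ← Real.cos_neg]
  congr 4
  ring

lemma cos_pi_mul_div_two_neg (hα : α ∈ Set.Ioo (1 : ℝ) 2) : Real.cos (π * α / 2) < 0 := by
  have := Real.pi_pos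
  refine Real.cos_neg_of_pi_div_two_lt_of_lt ?_ ?_ <;> nlinarith [hα.1, hα.2]

lemma glSymbol_le (hα : α ∈ Set.Ioo (1 : ℝ) 2) {θ : ℝ} (hθ : θ ∈ Set.Icc (-π) π) :
    glSymbol α θ ≤ 2 * |θ| ^ α := by
  wlog h0 : 0 ≤ θ generalizing θ
  · rw [← glSymbol_neg, ← abs_neg]
    exact this ⟨by linarith [hθ.2], by linarith [hθ.1]⟩ (by linarith)
  have hs : 0 ≤ 2 * Real.sin (θ / 2) := mul_nonneg zero_le_two
    (Real.sin_nonneg_of_nonneg_of_le_pi (by linarith) (by linarith [hθ.2]))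
  have hle : (2 * Real.sin (θ / 2)) ^ α ≤ θ ^ α :=
    Real.rpow_le_rpow hs (by linarith [Real.sin_le (show 0 ≤ θ / 2 by linarith)])
      (by linarith [hα.1])
  rw [glSymbol_eq hα ⟨h0, hθ.2⟩, abs_of_nonneg h0]
  have := Real.rpow_nonneg hs α
  nlinarith [Real.neg_one_le_cos (π * α / 2 + θ * (1 - α / 2))]

lemma rpow_le_mul_glSymbol (hα : α ∈ Set.Ioo (1 : ℝ) 2) {θ : ℝ} (hθ : θ ∈ Set.Icc (-π) π) :
    |θ| ^ α ≤ π ^ 2 / (-8 * Real.cos (π * α / 2)) * glSymbol α θ := by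
  wlog h0 : 0 ≤ θ generalizing θ
  · rw [← glSymbol_neg, ← abs_neg]
    exact this ⟨by linarith [hθ.2], by linarith [hθ.1]⟩ (by linarith)
  obtain ⟨hα1, hα2⟩ := id hα
  have hπ := Real.pi_pos
  have hs : 0 ≤ 2 * Real.sin (θ / 2) := mul_nonneg zero_le_two
    (Real.sin_nonneg_of_nonneg_of_le_pi (by linarith) (by linarith [hθ.2]))
  have hcos := cos_pi_mul_div_two_neg hα
  have hcos' : Real.cos (π * α / 2 + θ * (1 - α / 2)) ≤ Real.cos (π * α / 2) := by
    apply Real.cos_le_cos_of_nonneg_of_le_pi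
    · positivity
    · nlinarith [hθ.2]
    · nlinarith
  have hjordan : θ ≤ π / 2 * (2 * Real.sin (θ / 2)) := by
    have := Real.mul_le_sin (show 0 ≤ θ / 2 by linarith) (by linarith [hθ.2])
    have h := mul_le_mul_of_nonneg_left this hπ.le
    have e : π * (2 / π * (θ / 2)) = θ := by field_simp
    linarith
  have hpow : θ ^ α ≤ π ^ 2 / 4 * (2 * Real.sin (θ / 2)) ^ α :=
    calc θ ^ α ≤ (π / 2 * (2 * Real.sin (θ / 2))) ^ α :=
          Real.rpow_le_rpow h0 hjordan (by linarith)
      _ = (π / 2) ^ α * (2 * Real.sin (θ / 2)) ^ α := Real.mul_rpow (by positivity) hs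
      _ ≤ (π / 2) ^ (2 : ℝ) * (2 * Real.sin (θ / 2)) ^ α := by
          gcongr
          linarith [Real.two_le_pi]
      _ = π ^ 2 / 4 * (2 * Real.sin (θ / 2)) ^ α := by
          rw [Real.rpow_two]; ring
  have hr := Real.rpow_nonneg hs α
  rw [glSymbol_eq hα ⟨h0, hθ.2⟩, abs_of_nonneg h0, div_mul_eq_mul_div, le_div_iff₀ (by linarith)]
  have h3 := mul_le_mul_of_nonneg_right hpow (show 0 ≤ -8 * Real.cos (π * α / 2) by linarith)
  have h4 : 0 ≤ π ^ 2 * (2 * Real.sin (θ / 2)) ^ α := by positivity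
  have h5 := mul_le_mul_of_nonneg_left hcos' h4
  linarith

lemma glSymbol_nonneg (hα : α ∈ Set.Ioo (1 : ℝ) 2) {θ : ℝ} (hθ : θ ∈ Set.Icc (-π) π) :
    0 ≤ glSymbol α θ := by
  have h := (Real.rpow_nonneg (abs_nonneg θ) α).trans (rpow_le_mul_glSymbol hα hθ)
  refine nonneg_of_mul_nonneg_right h (div_pos (by positivity) ?_)
  linarith [cos_pi_mul_div_two_neg hα]

lemma integral_exp_int_mul (d : ℤ) :
    ∫ θ in Set.Icc (-π) π, Complex.exp (θ * d * Complex.I) =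
      if d = 0 then 2 * (π : ℂ) else 0 := by
  rw [integral_Icc_eq_integral_Ioc,
    ← intervalIntegral.integral_of_le (by linarith [Real.pi_pos])]
  split_ifs with hd
  · subst hd
    simp
    ring
  · have hd' : (d : ℂ) * Complex.I ≠ 0 := mul_ne_zero (by exact_mod_cast hd) Complex.I_ne_zero
    have h := integral_exp_mul_complex (a := -π) (b := π) hd'
    have e : ∀ θ : ℝ, (θ : ℂ) * d * Complex.I = d * Complex.I * θ := fun θ => by ring
    simp_rw [e]
    rw [h, div_eq_zero_iff]
    left
    rw [sub_eq_zero, Complex.exp_eq_exp_iff_exists_int]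
    exact ⟨d, by push_cast; ring⟩

lemma integral_cos_mul_exp (a d : ℤ) :
    ∫ θ in Set.Icc (-π) π, (Real.cos (a * θ) : ℂ) * Complex.exp (θ * d * Complex.I) =
      π * ((if a = d then 1 else 0) + if a = -d then 1 else 0) := by
  have e : ∀ θ : ℝ, (Real.cos (a * θ) : ℂ) * Complex.exp (θ * d * Complex.I) =
      (Complex.exp (θ * (d + a : ℤ) * Complex.I) +
        Complex.exp (θ * (d - a : ℤ) * Complex.I)) / 2 := fun θ => by
    rw [Complex.ofReal_cos, Complex.cos, div_mul_eq_mul_div, add_mul, ← Complex.exp_add,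
      ← Complex.exp_add]
    congr 3 <;> push_cast <;> ring
  simp_rw [e]
  rw [integral_div, integral_add, integral_exp_int_mul, integral_exp_int_mul]
  · have h1 : d + a = 0 ↔ a = -d := by omega
    have h2 : d - a = 0 ↔ a = d := by omega
    simp only [h1, h2]
    split_ifs <;> ring
  all_goals
    exact ContinuousOn.integrableOn_compact isCompact_Icc (by fun_prop)

lemma integral_glSymbol_mul_exp (hα : α ∈ Set.Ioo (1 : ℝ) 2) (d : ℤ) :
    ∫ θ in Set.Icc (-π) π, (glSymbol α θ : ℂ) * Complex.exp (θ * d * Complex.I) =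
      2 * π * tC α d.natAbs := by
  set F : ℕ → ℝ → ℂ := fun k θ =>
    (glCoef α k : ℂ) * ((Real.cos (((k - 1 : ℤ) : ℝ) * θ) : ℂ) * Complex.exp (θ * d * Complex.I))
    with hF
  have hFint : ∀ k, Integrable (F k) (volume.restrict (Set.Icc (-π) π)) := fun k =>
    ContinuousOn.integrableOn_compact isCompact_Icc (by fun_prop)
  have hnorm : ∀ k θ, ‖F k θ‖ ≤ ‖glCoef α k‖ := fun k θ => by
    have : (θ : ℂ) * d * Complex.I = ((θ * d : ℝ) : ℂ) * Complex.I := by push_cast; ring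
    rw [hF, norm_mul, norm_mul, this, Complex.norm_exp_ofReal_mul_I, mul_one, Complex.norm_real,
      Complex.norm_real]
    exact mul_le_of_le_one_right (norm_nonneg _) (Real.abs_cos_le_one _)
  have hsum : HasSum (fun k => ∫ θ in Set.Icc (-π) π, F k θ) (∫ θ in Set.Icc (-π) π, ∑' k, F k θ) := by
    refine hasSum_integral_of_summable_integral_norm hFint ?_
    refine Summable.of_nonneg_of_le (fun k => by positivity) (fun k => ?_)
      ((summable_glCoef hα).norm.mul_left (volume.real (Set.Icc (-π) π)))
    refine (integral_mono (hFint k).norm (integrable_const _) (hnorm k)).trans (le_of_eq ?_)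
    simp
  have hlhs : ∀ θ : ℝ, (glSymbol α θ : ℂ) * Complex.exp (θ * d * Complex.I) =
      -2 * ∑' k, F k θ := fun θ => by
    simp only [hF, ← mul_assoc, tsum_mul_right, glSymbol]
    push_cast
    rfl
  simp_rw [hlhs]
  rw [integral_const_mul, ← hsum.tsum_eq]
  have hval : ∀ k : ℕ, ∫ θ in Set.Icc (-π) π, F k θ = π * (glCoef α k *
      ((if (k : ℤ) - 1 = d then 1 else 0) + if (k : ℤ) - 1 = -d then 1 else 0)) := fun k => by
    simp only [hF]
    rw [integral_const_mul, integral_cos_mul_exp]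
    ring
  simp_rw [hval]
  rw [tsum_mul_left]
  have hcoef : ∑' k : ℕ, (glCoef α k : ℂ) *
      ((if (k : ℤ) - 1 = d then 1 else 0) + if (k : ℤ) - 1 = -d then 1 else 0) =
      -tC α d.natAbs := by
    rw [tsum_eq_sum (s := Finset.range (d.natAbs + 2)) fun k hk => by
      have := Finset.mem_range.not.1 hk
      rw [if_neg (by omega), if_neg (by omega)]
      simp]
    have hsplit : ∀ k : ℕ, ((if (k : ℤ) - 1 = d then 1 else 0) +
        if (k : ℤ) - 1 = -d then 1 else 0 : ℂ) =
        (if k = d.natAbs + 1 then 1 else 0) + if k + d.natAbs = 1 then 1 else 0 := fun k => by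
      rcases Int.natAbs_eq d with h | h <;> rw [h] <;> simp only [Int.natAbs_neg, Int.natAbs_natCast]
      · congr 2 <;> simp only [eq_iff_iff] <;> omega
      · rw [add_comm]
        congr 2 <;> simp only [eq_iff_iff] <;> omega
    simp_rw [hsplit]
    generalize d.natAbs = N
    match N with
    | 0 => simp [Finset.sum_range_succ, tC]; ring
    | 1 => simp [Finset.sum_range_succ, tC]
    | N + 2 =>
      have h1 : ∀ k, k + (N + 2) ≠ 1 := fun k => by omega
      simp [h1, tC]
  rw [hcoef]
  ring

end Symbol

section MultilevelToeplitz

variable {m : ℕ} {n : Fin m → ℕ}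

lemma isCompact_cube : IsCompact (Set.univ.pi fun _ : Fin m => Set.Icc (-π) π) :=
  isCompact_univ_pi fun _ => isCompact_Icc

lemma dotProduct_mToeplitz_mulVec {f : (Fin m → ℝ) → ℝ}
    (hf : IntegrableOn f (Set.univ.pi fun _ : Fin m => Set.Icc (-π) π))
    (z : ((i : Fin m) → Fin (n i)) → ℝ) :
    z ⬝ᵥ mToeplitz n f *ᵥ z = (2 * π) ^ (-(m : ℤ)) *
      ∫ θ in Set.univ.pi fun _ : Fin m => Set.Icc (-π) π,
        f θ * ((∑ x, z x * Real.cos (∑ i, θ i * (x i : ℕ))) ^ 2 +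
          (∑ x, z x * Real.sin (∑ i, θ i * (x i : ℕ))) ^ 2) := by
  have hint : ∀ x y : (i : Fin m) → Fin (n i), IntegrableOn (fun θ : Fin m → ℝ =>
      z x * z y * (f θ * Real.cos (∑ i, θ i * (((x i : ℕ) : ℝ) - ((y i : ℕ) : ℝ)))))
      (Set.univ.pi fun _ : Fin m => Set.Icc (-π) π) := fun x y =>
    (hf.mul_continuousOn (by fun_prop) isCompact_cube).const_mul _
  have hexpand : ∀ θ : Fin m → ℝ, f θ * ((∑ x, z x * Real.cos (∑ i, θ i * (x i : ℕ))) ^ 2 +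
      (∑ x, z x * Real.sin (∑ i, θ i * (x i : ℕ))) ^ 2) =
      ∑ x, ∑ y, z x * z y *
        (f θ * Real.cos (∑ i, θ i * (((x i : ℕ) : ℝ) - ((y i : ℕ) : ℝ)))) := fun θ => by
    simp only [mul_sub, Finset.sum_sub_distrib, Real.cos_sub]
    rw [sq, sq, Finset.sum_mul_sum, Finset.sum_mul_sum, ← Finset.sum_add_distrib, Finset.mul_sum]
    simp only [← Finset.sum_add_distrib, Finset.mul_sum]
    exact Finset.sum_congr rfl fun x _ => Finset.sum_congr rfl fun y _ => by ring
  simp_rw [hexpand]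
  rw [integral_finsetSum _ fun x _ => integrable_finsetSum _ fun y _ => hint x y, Finset.mul_sum]
  refine Finset.sum_congr rfl fun x _ => ?_
  rw [integral_finsetSum _ fun y _ => hint x y, mulVec, dotProduct, Finset.mul_sum,
    Finset.mul_sum]
  refine Finset.sum_congr rfl fun y _ => ?_
  rw [integral_const_mul, mToeplitz]
  ring

lemma mToeplitz_dotProduct_mono {f g : (Fin m → ℝ) → ℝ}
    (hf : IntegrableOn f (Set.univ.pi fun _ : Fin m => Set.Icc (-π) π))
    (hg : IntegrableOn g (Set.univ.pi fun _ : Fin m => Set.Icc (-π) π)) {a b : ℝ}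
    (h : ∀ θ ∈ Set.univ.pi fun _ : Fin m => Set.Icc (-π) π, a * f θ ≤ b * g θ)
    (z : ((i : Fin m) → Fin (n i)) → ℝ) :
    a * (z ⬝ᵥ mToeplitz n f *ᵥ z) ≤ b * (z ⬝ᵥ mToeplitz n g *ᵥ z) := by
  rw [dotProduct_mToeplitz_mulVec hf, dotProduct_mToeplitz_mulVec hg, mul_left_comm,
    mul_left_comm b, ← integral_const_mul a, ← integral_const_mul b]
  refine mul_le_mul_of_nonneg_left ?_ (zpow_nonneg (a := 2 * π) (by positivity) _)
  refine setIntegral_mono_on ?_ ?_ isCompact_cube.measurableSet fun θ hθ => ?_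
  · exact (hf.mul_continuousOn (by fun_prop) isCompact_cube).const_mul _
  · exact (hg.mul_continuousOn (by fun_prop) isCompact_cube).const_mul _
  · rw [← mul_assoc, ← mul_assoc]
    exact mul_le_mul_of_nonneg_right (h θ hθ) (by positivity)

lemma integral_glSymbol_mul_cos {α : ℝ} (hα : α ∈ Set.Ioo (1 : ℝ) 2) (i : Fin m)
    (d : Fin m → ℤ) :
    ∫ θ in Set.univ.pi fun _ : Fin m => Set.Icc (-π) π,
        glSymbol α (θ i) * Real.cos (∑ j, θ j * d j) =
      (2 * π) ^ m * (tC α (d i).natAbs * ∏ j ∈ Finset.univ.erase i, if d j = 0 then 1 else 0) := by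
  set F : Fin m → ℝ → ℂ := fun j t =>
    (if j = i then (glSymbol α t : ℂ) else 1) * Complex.exp (t * d j * Complex.I) with hF
  have hprod : ∀ θ : Fin m → ℝ, ∏ j, F j (θ j) =
      glSymbol α (θ i) * Complex.exp ((∑ j, θ j * d j : ℝ) * Complex.I) := fun θ => by
    simp only [hF, Finset.prod_mul_distrib, ← Complex.exp_sum, ← Finset.sum_mul]
    rw [Finset.prod_ite_eq' Finset.univ i, if_pos (Finset.mem_univ _)]
    push_cast
    rfl
  have hcomplex : ∫ θ in Set.univ.pi fun _ : Fin m => Set.Icc (-π) π, ∏ j, F j (θ j) =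
      ((2 * π) ^ m * (tC α (d i).natAbs *
        ∏ j ∈ Finset.univ.erase i, if d j = 0 then 1 else 0) : ℝ) := by
    rw [volume_pi, Measure.restrict_pi_pi, integral_fintype_prod_eq_prod,
      ← Finset.mul_prod_erase _ _ (Finset.mem_univ i)]
    have hi : ∫ t in Set.Icc (-π) π, F i t = 2 * π * tC α (d i).natAbs := by
      simp only [hF, if_true]
      exact integral_glSymbol_mul_exp hα (d i)
    have hj : ∀ j ∈ Finset.univ.erase i, ∫ t in Set.Icc (-π) π, F j t =
        2 * (π : ℂ) * if d j = 0 then 1 else 0 := fun j hj => by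
      simp only [hF, Finset.ne_of_mem_erase hj, if_false, one_mul]
      rw [integral_exp_int_mul, mul_ite, mul_one, mul_zero]
    rw [hi, Finset.prod_congr rfl hj, Finset.prod_mul_distrib, Finset.prod_const,
      Finset.card_erase_of_mem (Finset.mem_univ i), Finset.card_univ, Fintype.card_fin]
    obtain ⟨m, rfl⟩ : ∃ k, m = k + 1 := ⟨m - 1, by have := i.pos; omega⟩
    push_cast [Nat.add_sub_cancel, apply_ite Complex.ofReal]
    rw [pow_succ]
    ring
  have hint : IntegrableOn (fun θ : Fin m → ℝ => ∏ j, F j (θ j))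
      (Set.univ.pi fun _ : Fin m => Set.Icc (-π) π) := by
    refine ContinuousOn.integrableOn_compact isCompact_cube ?_
    have := continuous_glSymbol hα
    simp_rw [hprod]
    fun_prop
  have hre := integral_re hint
  have key : ∀ θ : Fin m → ℝ, RCLike.re (∏ j, F j (θ j)) =
      glSymbol α (θ i) * Real.cos (∑ j, θ j * d j) := fun θ => by
    rw [hprod]
    change Complex.re _ = _
    rw [Complex.re_ofReal_mul, Complex.exp_ofReal_mul_I_re]
  simp_rw [key] at hre
  rw [hre, hcomplex]
  exact Complex.ofReal_re _

lemma continuous_sum_glSymbol {α : Fin m → ℝ} (hα : ∀ i, α i ∈ Set.Ioo (1 : ℝ) 2)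
    (l : Fin m → ℝ) : Continuous fun θ : Fin m → ℝ => ∑ i, l i * glSymbol (α i) (θ i) :=
  continuous_finsetSum _ fun i _ =>
    continuous_const.mul ((continuous_glSymbol (hα i)).comp (continuous_apply i))

lemma mToeplitz_sum_glSymbol {α : Fin m → ℝ} (hα : ∀ i, α i ∈ Set.Ioo (1 : ℝ) 2)
    (l : Fin m → ℝ) :
    mToeplitz n (fun θ => ∑ i, l i * glSymbol (α i) (θ i)) =
      multilevel n (fun i => l i • Gmat (α i) (n i)) := by
  ext x y
  set d : Fin m → ℤ := fun i => (x i : ℕ) - (y i : ℕ) with hd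
  have hcast : ∀ i, ((x i : ℕ) : ℝ) - ((y i : ℕ) : ℝ) = d i := fun i => by simp [hd]
  have hdist : ∀ i, Nat.dist (x i) (y i) = (d i).natAbs := fun i => by
    simp only [hd, Nat.dist]; omega
  have heq : ∀ i, x i = y i ↔ d i = 0 := fun i => by
    simp only [hd, Fin.ext_iff]; omega
  simp only [mToeplitz, multilevel, hcast, Finset.sum_mul, mul_assoc, Gmat, toeplitzM, hdist, heq,
    Matrix.smul_apply, smul_eq_mul]
  rw [integral_finsetSum, Finset.mul_sum]
  · refine Finset.sum_congr rfl fun i _ => ?_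
    rw [integral_const_mul, integral_glSymbol_mul_cos (hα i)]
    have : (2 * π) ^ m ≠ 0 := by positivity
    rw [_root_.zpow_neg, zpow_natCast]
    field_simp
  · intro i _
    refine ContinuousOn.integrableOn_compact isCompact_cube ?_
    have := continuous_glSymbol (hα i)
    fun_prop

end MultilevelToeplitz

theorem rayleigh_B_tau (m : ℕ) (hm : 1 ≤ m) (n : Fin m → ℕ) (hn : ∀ i, 1 ≤ n i)
    (α l : Fin m → ℝ) (hα : ∀ i, α i ∈ Set.Ioo (1 : ℝ) 2) (hl : ∀ i, 0 < l i)
    (p : (Fin m → ℝ) → ℝ)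
    (hp : IntegrableOn p (Set.univ.pi fun _ : Fin m => Set.Icc (-π) π))
    (c0 c1 : ℝ) (hc0 : 0 < c0) (hc01 : c0 ≤ c1)
    (hpq : ∀ θ : Fin m → ℝ, (∀ i, θ i ∈ Set.Icc (-π) π) →
      c0 * (∑ i, l i * |θ i| ^ (α i)) ≤ p θ ∧ p θ ≤ c1 * (∑ i, l i * |θ i| ^ (α i)))
    (c2 : ℝ)
    (hc2 : c2 = Finset.univ.sup' ⟨(⟨0, hm⟩ : Fin m), Finset.mem_univ _⟩
      (fun i => π ^ 2 / (-8 * Real.cos (π * α i / 2))))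
    (z : ((i : Fin m) → Fin (n i)) → ℝ) (hz : z ≠ 0) :
    (c0 / 4) * (z ⬝ᵥ (multilevel n (fun i => l i • tauM (n i) (tC (α i)))).mulVec z) ≤
      z ⬝ᵥ (mToeplitz n p).mulVec z ∧
    z ⬝ᵥ (mToeplitz n p).mulVec z ≤
      (3 * c1 * c2 / 2) *
        (z ⬝ᵥ (multilevel n (fun i => l i • tauM (n i) (tC (α i)))).mulVec z) := by
  have hc2i : ∀ i, π ^ 2 / (-8 * Real.cos (π * α i / 2)) ≤ c2 := fun i =>
    hc2 ▸ Finset.le_sup' (fun i => π ^ 2 / (-8 * Real.cos (π * α i / 2))) (Finset.mem_univ i)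
  have hc2pos : 0 ≤ c2 := by
    refine (div_nonneg (by positivity) ?_).trans (hc2i ⟨0, hm⟩)
    linarith [cos_pi_mul_div_two_neg (hα ⟨0, hm⟩)]
  have hc1 : 0 ≤ c1 := hc0.le.trans hc01
  have hs : IntegrableOn (fun θ : Fin m → ℝ => ∑ i, l i * glSymbol (α i) (θ i))
      (Set.univ.pi fun _ : Fin m => Set.Icc (-π) π) :=
    (continuous_sum_glSymbol hα l).continuousOn.integrableOn_compact isCompact_cube
  have hlow := mToeplitz_dotProduct_mono (a := c0 / 2) (b := 1) (n := n) hs hp (fun θ hθ => by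
    have hθ' : ∀ i, θ i ∈ Set.Icc (-π) π := fun i => hθ i (Set.mem_univ i)
    have h : ∑ i, l i * glSymbol (α i) (θ i) ≤ 2 * ∑ i, l i * |θ i| ^ α i := by
      rw [Finset.mul_sum]
      refine Finset.sum_le_sum fun i _ => ?_
      rw [mul_left_comm]
      exact mul_le_mul_of_nonneg_left (glSymbol_le (hα i) (hθ' i)) (hl i).le
    have := mul_le_mul_of_nonneg_left h (show 0 ≤ c0 / 2 by positivity)
    linarith [(hpq θ hθ').1]) z
  have hup := mToeplitz_dotProduct_mono (a := 1) (b := c1 * c2) (n := n) hp hs (fun θ hθ => by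
    have hθ' : ∀ i, θ i ∈ Set.Icc (-π) π := fun i => hθ i (Set.mem_univ i)
    have h : ∑ i, l i * |θ i| ^ α i ≤ c2 * ∑ i, l i * glSymbol (α i) (θ i) := by
      rw [Finset.mul_sum]
      refine Finset.sum_le_sum fun i _ => ?_
      rw [mul_left_comm]
      refine mul_le_mul_of_nonneg_left ((rpow_le_mul_glSymbol (hα i) (hθ' i)).trans ?_) (hl i).le
      exact mul_le_mul_of_nonneg_right (hc2i i) (glSymbol_nonneg (hα i) (hθ' i))
    have := mul_le_mul_of_nonneg_left h hc1
    linarith [(hpq θ hθ').2]) z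
  rw [mToeplitz_sum_glSymbol hα] at hlow hup
  have hG := multilevel_dotProduct_mono (n := n) (M := fun i => l i • tauM (n i) (tC (α i)))
    (M' := fun i => l i • Gmat (α i) (n i)) (a := 1) (b := 2) (fun i => by
      convert (posSemidef_two_smul_Gmat_sub_tauM (hα i) (n i)).smul (hl i).le using 1
      module) z
  have hτ := multilevel_dotProduct_mono (n := n) (M := fun i => l i • Gmat (α i) (n i))
    (M' := fun i => l i • tauM (n i) (tC (α i))) (a := 2) (b := 3) (fun i => by
      convert (posSemidef_three_smul_tauM_sub_Gmat (hα i) (n i)).smul (hl i).le using 1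
      module) z
  constructor
  · have := mul_le_mul_of_nonneg_left hG (show 0 ≤ c0 / 4 by positivity)
    linarith
  · have := mul_le_mul_of_nonneg_left hτ (show 0 ≤ c1 * c2 / 2 by positivity)
    linarith
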